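/- Let τ be a critical Galton–Watson tree with offspring distribution p, and let M(t) = sup{k_u(t) : u ∈ t} denote the maximal out-degree of a tree t. Then, along the infinite subsequence {n ∈ ℕ : p_n > 0}, τ conditioned on {M(τ) = n} converges locally in distribution to the immortal tree τ* as n → ∞: for every h ∈ ℕ and every tree t of height at most h, lim_{n→∞} P[r_h(τ) = t | M(τ) = n] = P[r_h(τ*) = t]. -/

import Mathlib

open MeasureTheory Filter Set ProbabilityTheory
open scoped ENNReal Topology

namespace GWLocal

/-- Nodes of trees: finite sequences of positive integers. -/
abbrev Node : Type := List ℕ+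

/-- A (rooted planar) tree, as a subset of the set `U` of finite sequences of positive
integers: it contains the root `[]`, is closed under taking prefixes, and the children of
any node `u` form an initial segment `u1, …, uk` for some `k ∈ ℤ₊` (the out-degree of `u`). -/
def IsTree (t : Set Node) : Prop :=
  (([] : Node) ∈ t) ∧
  (∀ u ∈ t, ∀ v : Node, v <+: u → v ∈ t) ∧
  (∀ u ∈ t, ∃ k : ℕ, ∀ i : ℕ+, (u ++ [i]) ∈ t ↔ (i : ℕ) ≤ k)

/-- The out-degree `k_u(t)` of the node `u` in the tree `t`. -/
noncomputable def deg (t : Set Node) (u : Node) : ℕ := {i : ℕ+ | (u ++ [i]) ∈ t}.ncard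

/-- `restrict h t = r_h(t)`, the tree `t` restricted below height `h`. -/
def restrict (h : ℕ) (t : Set Node) : Set Node := {u ∈ t | u.length ≤ h}

/-- `Y h t = Y_h(t)`, the number of nodes of `t` at height `h`. -/
noncomputable def Y (h : ℕ) (t : Set Node) : ℕ := {u ∈ t | u.length = h}.ncard

/-- The height `H(t) = sup{|u| : u ∈ t}` of a tree. -/
noncomputable def height (t : Set Node) : ℕ∞ := ⨆ u ∈ t, (u.length : ℕ∞)

/-- The width `W(t) = sup_{h ∈ ℤ₊} Y_h(t)` of a tree. -/
noncomputable def width (t : Set Node) : ℕ∞ := ⨆ h : ℕ, (Y h t : ℕ∞)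

/-- The subtree of `t` above the node `u`, re-rooted at `u`. -/
def subtreeAt (t : Set Node) (u : Node) : Set Node := {v | u ++ v ∈ t}

/-- The mean `μ = Σ_k k p_k` of an offspring distribution `p`. -/
noncomputable def mean (p : PMF ℕ) : ℝ≥0∞ := ∑' k : ℕ, (k : ℝ≥0∞) * p k

/-- `∏_{u ∈ t, |u| < h} p_{k_u(t)}`: the probability that a GW tree with offspring
distribution `p`, restricted below height `h`, equals `t`. -/
noncomputable def cylProb (p : PMF ℕ) (h : ℕ) (t : Set Node) : ℝ≥0∞ :=
  ∏ᶠ u ∈ {u ∈ t | u.length < h}, p (deg t u)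

/-- `μ^{-b} Y_b(t) ∏_{u ∈ t, |u| < b} p_{k_u(t)}`: the probability that Kesten's immortal
tree `τ*` associated with `p`, restricted below height `b`, equals `t`. -/
noncomputable def kesten (p : PMF ℕ) (b : ℕ) (t : Set Node) : ℝ≥0∞ :=
  ((mean p)⁻¹) ^ b * (Y b t : ℝ≥0∞) * cylProb p b t

/-- The σ-algebra on the space of trees generated by the events `{t : r_h(t) = s}`
(the Borel σ-algebra of the local ultrametric on trees). -/
def treeσ : MeasurableSpace (Set Node) :=
  MeasurableSpace.generateFrom
    {S : Set (Set Node) | ∃ (h : ℕ) (s : Set Node), S = {t | restrict h t = s}}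

/-- `τ` is a Galton–Watson tree with offspring distribution `p` under `P`:
it takes values in trees, is measurable, and for every `h ∈ ℕ = {1,2,…}` and every tree `t`
of height at most `h`, `P[r_h(τ) = t] = ∏_{u ∈ t, |u| < h} p_{k_u(t)}`. -/
def IsGW {Ω : Type*} [MeasurableSpace Ω] (P : Measure Ω) (p : PMF ℕ)
    (τ : Ω → Set Node) : Prop :=
  (∀ ω, IsTree (τ ω)) ∧ (@Measurable Ω (Set Node) _ treeσ τ) ∧
  (∀ h : ℕ, 1 ≤ h → ∀ t : Set Node, IsTree t → height t ≤ (h : ℕ∞) →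
    P {ω | restrict h (τ ω) = t} = cylProb p h t)

/-- The maximal out-degree `M(t) = sup{k_u(t) : u ∈ t}` of a tree. -/
noncomputable def maxDeg (t : Set Node) : ℕ∞ := ⨆ u ∈ t, (deg t u : ℕ∞)

theorem height_le_iff {t : Set Node} {h : ℕ} :
    height t ≤ (h : ℕ∞) ↔ ∀ u ∈ t, u.length ≤ h := by
  simp [height]

theorem maxDeg_le_iff {t : Set Node} {n : ℕ} :
    maxDeg t ≤ (n : ℕ∞) ↔ ∀ u ∈ t, deg t u ≤ n := by
  simp [maxDeg]

theorem ncard_pnat_le (k : ℕ) : {i : ℕ+ | (i : ℕ) ≤ k}.ncard = k := by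
  have h : ((↑) : ℕ+ → ℕ) '' {i : ℕ+ | (i : ℕ) ≤ k} = ↑(Finset.Icc 1 k) := by
    ext j
    simp only [mem_image, mem_ofPred_eq, Finset.coe_Icc, mem_Icc]
    constructor
    · rintro ⟨i, hi, rfl⟩
      exact ⟨i.pos, hi⟩
    · rintro ⟨h1, h2⟩
      exact ⟨⟨j, h1⟩, h2, rfl⟩
  rw [← ncard_image_of_injective _ PNat.coe_injective, h, ncard_coe_finset]
  simp

theorem deg_eq_of_mem_iff {t : Set Node} {u : Node} {k : ℕ}
    (hk : ∀ i : ℕ+, (u ++ [i]) ∈ t ↔ (i : ℕ) ≤ k) : deg t u = k := by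
  rw [deg, show {i : ℕ+ | (u ++ [i]) ∈ t} = {i : ℕ+ | (i : ℕ) ≤ k} from Set.ext hk,
    ncard_pnat_le]

theorem IsTree.append_mem_iff {t : Set Node} (ht : IsTree t) {u : Node} (hu : u ∈ t) (i : ℕ+) :
    (u ++ [i]) ∈ t ↔ (i : ℕ) ≤ deg t u := by
  obtain ⟨k, hk⟩ := ht.2.2 u hu
  rw [deg_eq_of_mem_iff hk, hk]

theorem IsTree.mem_of_append {t : Set Node} (ht : IsTree t) {u v : Node} (hu : u ++ v ∈ t) :
    u ∈ t :=
  ht.2.1 _ hu _ (List.prefix_append u v)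

/-- The nodes of `t` at height `h`. -/
def level (h : ℕ) (t : Set Node) : Set Node := {u ∈ t | u.length = h}

theorem eq_append_of_length_succ {v : Node} {h : ℕ} (hv : v.length = h + 1) :
    ∃ (u : Node) (i : ℕ+), v = u ++ [i] ∧ u.length = h := by
  have hne : v ≠ [] := by
    rintro rfl
    simp at hv
  refine ⟨v.dropLast, v.getLast hne, (List.dropLast_append_getLast hne).symm, ?_⟩
  simp [hv]

theorem IsTree.level_succ {t : Set Node} (ht : IsTree t) (h : ℕ) :
    level (h + 1) t =
      ⋃ u ∈ level h t, (fun i : ℕ+ => u ++ [i]) '' {i : ℕ+ | (i : ℕ) ≤ deg t u} := by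
  ext v
  simp only [mem_iUnion, mem_image, mem_ofPred_eq, exists_prop]
  constructor
  · rintro ⟨hv, hl⟩
    obtain ⟨u, i, rfl, hu⟩ := eq_append_of_length_succ hl
    have hut := ht.mem_of_append hv
    exact ⟨u, ⟨hut, hu⟩, i, (ht.append_mem_iff hut i).1 hv, rfl⟩
  · rintro ⟨u, ⟨hut, hu⟩, i, hi, rfl⟩
    exact ⟨(ht.append_mem_iff hut i).2 hi, by simp [hu]⟩

theorem finite_pnat_le (k : ℕ) : {i : ℕ+ | (i : ℕ) ≤ k}.Finite :=
  (Set.finite_Iic k).preimage PNat.coe_injective.injOn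

theorem IsTree.finite_level {t : Set Node} (ht : IsTree t) (h : ℕ) : (level h t).Finite := by
  induction h with
  | zero =>
    refine (Set.finite_singleton ([] : Node)).subset ?_
    rintro u ⟨-, hu⟩
    simpa using hu
  | succ h ih =>
    rw [ht.level_succ]
    exact ih.biUnion fun u _ => (finite_pnat_le _).image _

theorem IsTree.finite_lt {t : Set Node} (ht : IsTree t) (h : ℕ) :
    {u ∈ t | u.length < h}.Finite := by
  refine ((Set.finite_Iio h).biUnion fun k _ => ht.finite_level k).subset ?_
  rintro u ⟨hu, hl⟩
  simp only [mem_iUnion]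
  exact ⟨u.length, hl, hu, rfl⟩

theorem IsTree.Y_succ {t : Set Node} (ht : IsTree t) {h : ℕ} {L : Finset Node}
    (hL : (L : Set Node) = level h t) : Y (h + 1) t = ∑ u ∈ L, deg t u := by
  classical
  have hinj : ∀ u : Node, Function.Injective (fun i : ℕ+ => u ++ [i]) := by
    intro u i j hij
    simpa using hij
  have hlev : level (h + 1) t =
      ↑(L.biUnion fun u => (finite_pnat_le (deg t u)).toFinset.image fun i : ℕ+ => u ++ [i]) := by
    rw [ht.level_succ, ← hL]
    simp
  change (level (h + 1) t).ncard = _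
  rw [hlev, ncard_coe_finset, Finset.card_biUnion]
  · refine Finset.sum_congr rfl fun u _ => ?_
    rw [Finset.card_image_of_injective _ (hinj u), ← ncard_eq_toFinset_card _ (finite_pnat_le _),
      ncard_pnat_le]
  · intro u _ v _ huv
    simp only [Function.onFun]
    rw [Finset.disjoint_left]
    intro w hw hw'
    obtain ⟨i, -, rfl⟩ := Finset.mem_image.1 hw
    obtain ⟨j, -, hj⟩ := Finset.mem_image.1 hw'
    exact huv (List.append_inj_left' hj rfl).symm

/-- The tree obtained from `t` by giving `d u` children to each node `u` of `L`. -/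
def graft (t : Set Node) (L : Finset Node) (d : L → ℕ) : Set Node :=
  {v | v ∈ t ∨ ∃ (u : L) (i : ℕ+), v = u ++ [i] ∧ (i : ℕ) ≤ d u}

section Graft

variable {t : Set Node} {h : ℕ} {L : Finset Node}

theorem length_le_of_mem_graft (hh : ∀ u ∈ t, u.length ≤ h)
    (hL : (L : Set Node) = level h t) (d : L → ℕ) : ∀ v ∈ graft t L d, v.length ≤ h + 1 := by
  rintro v (hv | ⟨⟨u, hu⟩, i, rfl, -⟩)
  · exact (hh v hv).trans (Nat.le_succ h)
  · have : u ∈ level h t := hL ▸ hu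
    simp [this.2]

theorem mem_graft_of_length_le (hL : (L : Set Node) = level h t) (d : L → ℕ) {v : Node}
    (hv : v.length ≤ h) : v ∈ graft t L d ↔ v ∈ t := by
  refine ⟨?_, Or.inl⟩
  rintro (hv' | ⟨⟨u, hu⟩, i, rfl, -⟩)
  · exact hv'
  · have : u ∈ level h t := hL ▸ hu
    have := this.2
    simp at hv
    omega

theorem append_mem_graft (hh : ∀ u ∈ t, u.length ≤ h) (hL : (L : Set Node) = level h t)
    (d : L → ℕ) (u : L) (i : ℕ+) : (u : Node) ++ [i] ∈ graft t L d ↔ (i : ℕ) ≤ d u := by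
  have hu : (u : Node) ∈ level h t := hL ▸ u.2
  constructor
  · rintro (hv | ⟨w, j, hwj, hj⟩)
    · have := hh _ hv
      have := hu.2
      simp at *
      omega
    · obtain ⟨h1, h2⟩ := List.append_inj' hwj rfl
      obtain rfl : u = w := Subtype.ext h1
      simp only [List.cons.injEq, and_true] at h2
      rwa [h2]
  · intro hi
    exact Or.inr ⟨u, i, rfl, hi⟩

theorem restrict_graft (hh : ∀ u ∈ t, u.length ≤ h) (hL : (L : Set Node) = level h t)
    (d : L → ℕ) : restrict h (graft t L d) = t := by
  ext v
  constructor
  · rintro ⟨hv, hl⟩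
    exact (mem_graft_of_length_le hL d hl).1 hv
  · intro hv
    exact ⟨Or.inl hv, hh v hv⟩

theorem deg_graft_of_mem (hh : ∀ u ∈ t, u.length ≤ h) (hL : (L : Set Node) = level h t)
    (d : L → ℕ) (u : L) : deg (graft t L d) u = d u :=
  deg_eq_of_mem_iff (append_mem_graft hh hL d u)

theorem deg_graft_of_length_lt (hL : (L : Set Node) = level h t) (d : L → ℕ) {u : Node}
    (hu : u.length < h) : deg (graft t L d) u = deg t u := by
  have (i : ℕ+) : u ++ [i] ∈ graft t L d ↔ u ++ [i] ∈ t :=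
    mem_graft_of_length_le hL d (by simpa using hu)
  simp only [deg, this]

theorem IsTree.graft (ht : IsTree t) (hh : ∀ u ∈ t, u.length ≤ h)
    (hL : (L : Set Node) = level h t) (d : L → ℕ) : IsTree (graft t L d) := by
  refine ⟨Or.inl ht.1, ?_, ?_⟩
  · rintro v (hv | ⟨u, i, rfl, hi⟩) w hw
    · exact Or.inl (ht.2.1 v hv w hw)
    · have hu : (u : Node) ∈ level h t := hL ▸ u.2
      rcases List.prefix_concat_iff.1 hw with rfl | hw
      · exact Or.inr ⟨u, i, rfl, hi⟩
      · exact Or.inl (ht.2.1 _ hu.1 _ hw)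
  · intro v hv
    rcases lt_trichotomy v.length h with hl | hl | hl
    · refine ⟨deg t v, fun i => ?_⟩
      rw [mem_graft_of_length_le hL d (by simpa using hl)]
      exact ht.append_mem_iff ((mem_graft_of_length_le hL d hl.le).1 hv) i
    · have hvL : v ∈ L := by
        rw [← Finset.mem_coe, hL]
        exact ⟨(mem_graft_of_length_le hL d hl.le).1 hv, hl⟩
      exact ⟨d ⟨v, hvL⟩, append_mem_graft hh hL d ⟨v, hvL⟩⟩
    · refine ⟨0, fun i => ⟨fun hi => ?_, fun hi => absurd i.pos (by omega)⟩⟩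
      have := length_le_of_mem_graft hh hL d _ hi
      simp at this
      omega

theorem level_graft (hL : (L : Set Node) = level h t) (d : L → ℕ) :
    level h (graft t L d) = level h t := by
  ext v
  constructor
  · rintro ⟨hv, hl⟩
    exact ⟨(mem_graft_of_length_le hL d hl.le).1 hv, hl⟩
  · rintro ⟨hv, hl⟩
    exact ⟨Or.inl hv, hl⟩

theorem Y_graft (ht : IsTree t) (hh : ∀ u ∈ t, u.length ≤ h)
    (hL : (L : Set Node) = level h t) (d : L → ℕ) :
    Y (h + 1) (graft t L d) = ∑ u, d u := by
  rw [(ht.graft hh hL d).Y_succ (hL.trans (level_graft hL d).symm), ← Finset.sum_coe_sort]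
  exact Finset.sum_congr rfl fun u _ => deg_graft_of_mem hh hL d u

theorem cylProb_graft (p : PMF ℕ) (ht : IsTree t) (hh : ∀ u ∈ t, u.length ≤ h)
    (hL : (L : Set Node) = level h t) (d : L → ℕ) :
    cylProb p (h + 1) (graft t L d) = cylProb p h t * ∏ u, p (d u) := by
  have hset : {u ∈ graft t L d | u.length < h + 1} = {u ∈ t | u.length < h} ∪ ↑L := by
    ext v
    rw [hL]
    simp only [level, mem_ofPred_eq, mem_union]
    constructor
    · rintro ⟨hv, hl⟩
      have := (mem_graft_of_length_le hL d (Nat.lt_succ_iff.1 hl)).1 hv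
      rcases Nat.lt_succ_iff_lt_or_eq.1 hl with h' | h'
      · exact Or.inl ⟨this, h'⟩
      · exact Or.inr ⟨this, h'⟩
    · rintro (⟨hv, hl⟩ | ⟨hv, hl⟩)
      · exact ⟨Or.inl hv, by omega⟩
      · exact ⟨Or.inl hv, by omega⟩
  have hdisj : Disjoint {u ∈ t | u.length < h} (L : Set Node) := by
    rw [hL, Set.disjoint_left]
    rintro v ⟨-, h1⟩ ⟨-, h2⟩
    omega
  rw [cylProb, hset, finprod_mem_union hdisj (ht.finite_lt h) L.finite_toSet,
    finprod_mem_coe_finset, ← Finset.prod_coe_sort]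
  congr 1
  · refine finprod_mem_congr rfl fun u hu => ?_
    rw [deg_graft_of_length_lt hL d hu.2]
  · exact Finset.prod_congr rfl fun u _ => by rw [deg_graft_of_mem hh hL d u]

theorem restrict_succ_eq_graft_iff {s : Set Node} (hs : IsTree s)
    (hh : ∀ u ∈ t, u.length ≤ h) (hL : (L : Set Node) = level h t) (d : L → ℕ) :
    restrict (h + 1) s = graft t L d ↔ restrict h s = t ∧ ∀ u : L, deg s u = d u := by
  constructor
  · intro hr
    have hmem : ∀ v : Node, v.length ≤ h + 1 → (v ∈ s ↔ v ∈ graft t L d) := fun v hv => by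
      rw [← hr]
      exact ⟨fun hvs => ⟨hvs, hv⟩, fun hvs => hvs.1⟩
    refine ⟨?_, fun u => ?_⟩
    · rw [← restrict_graft hh hL d]
      ext v
      constructor
      · rintro ⟨hv, hl⟩
        exact ⟨(hmem v (by omega)).1 hv, hl⟩
      · rintro ⟨hv, hl⟩
        exact ⟨(hmem v (by omega)).2 hv, hl⟩
    · have hu : (u : Node) ∈ level h t := hL ▸ u.2
      refine deg_eq_of_mem_iff fun i => ?_
      rw [hmem _ (by simp [hu.2]), append_mem_graft hh hL d u i]
  · rintro ⟨rfl, hd⟩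
    ext v
    constructor
    · rintro ⟨hv, hl⟩
      rcases Nat.le_succ_iff.1 hl with hl | hl
      · exact Or.inl ⟨hv, hl⟩
      · obtain ⟨u, i, rfl, hu⟩ := eq_append_of_length_succ hl
        have hus := hs.mem_of_append hv
        have huL : u ∈ L := by
          rw [← Finset.mem_coe, hL]
          exact ⟨⟨hus, hu.le⟩, hu⟩
        refine Or.inr ⟨⟨u, huL⟩, i, rfl, ?_⟩
        rw [← hd]
        exact (hs.append_mem_iff hus i).1 hv
    · rintro (hv | ⟨u, i, rfl, hi⟩)
      · exact ⟨hv.1, hv.2.trans (Nat.le_succ h)⟩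
      · have hu : (u : Node) ∈ level h (restrict h s) := hL ▸ u.2
        refine ⟨(hs.append_mem_iff hu.1.1 i).2 ?_, by simp [hu.2]⟩
        rwa [hd]

end Graft

/-- The trees that agree with `t` up to height `h` and whose nodes at heights
`h, …, h + k - 1` have at most `n` children. -/
def cylDegLe (n h k : ℕ) (t : Set Node) : Set (Set Node) :=
  {s | restrict h s = t ∧ ∀ u ∈ s, h ≤ u.length → u.length < h + k → deg s u ≤ n}

theorem mem_cylDegLe_succ_iff {s t : Set Node} (hs : IsTree s) {n h k : ℕ} {L : Finset Node}
    (hh : ∀ u ∈ t, u.length ≤ h) (hL : (L : Set Node) = level h t) :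
    s ∈ cylDegLe n h (k + 1) t ↔
      ∃ d ∈ Fintype.piFinset (fun _ : L => Finset.range (n + 1)),
        s ∈ cylDegLe n (h + 1) k (graft t L d) := by
  simp only [cylDegLe, mem_ofPred_eq, restrict_succ_eq_graft_iff hs hh hL, Fintype.mem_piFinset,
    Finset.mem_range, Nat.lt_succ_iff]
  constructor
  · rintro ⟨hr, hdeg⟩
    refine ⟨fun u => deg s u, fun u => ?_, ⟨hr, fun _ => rfl⟩,
      fun u hu h1 h2 => hdeg u hu (by omega) (by omega)⟩
    have hu : (u : Node) ∈ level h t := hL ▸ u.2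
    have hus : (u : Node) ∈ restrict h s := hr ▸ hu.1
    exact hdeg u hus.1 hu.2.ge (by have := hu.2; omega)
  · rintro ⟨d, hd, ⟨hr, hdu⟩, hdeg⟩
    refine ⟨hr, fun u hu h1 h2 => ?_⟩
    rcases h1.eq_or_lt with h1 | h1
    · have huL : u ∈ L := by
        rw [← Finset.mem_coe, hL, ← hr]
        exact ⟨⟨hu, h1.ge⟩, h1.symm⟩
      exact (hdu ⟨u, huL⟩).trans_le (hd ⟨u, huL⟩)
    · exact hdeg u hu h1 (by omega)

/-- The generating function of `p` truncated at degree `n`. -/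
noncomputable def truncGen (p : PMF ℕ) (n : ℕ) (x : ℝ≥0∞) : ℝ≥0∞ :=
  ∑ j ∈ Finset.range (n + 1), p j * x ^ j

theorem continuous_truncGen (p : PMF ℕ) (n : ℕ) : Continuous (truncGen p n) :=
  continuous_finsetSum _ fun j _ =>
    (ENNReal.continuous_const_mul (p.apply_ne_top j)).comp (ENNReal.continuous_pow j)

theorem truncGen_pow_Y (p : PMF ℕ) {t : Set Node} (ht : IsTree t) {n h : ℕ} {L : Finset Node}
    (hh : ∀ u ∈ t, u.length ≤ h) (hL : (L : Set Node) = level h t) (x : ℝ≥0∞) :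
    ∑ d ∈ Fintype.piFinset (fun _ : L => Finset.range (n + 1)),
        cylProb p (h + 1) (graft t L d) * x ^ Y (h + 1) (graft t L d) =
      cylProb p h t * truncGen p n x ^ Y h t := by
  have hY : Y h t = Fintype.card L := by
    change (level h t).ncard = _
    rw [← hL, ncard_coe_finset, Fintype.card_coe]
  rw [hY, truncGen, ← Finset.card_univ, ← Finset.prod_const, Finset.prod_univ_sum,
    Finset.mul_sum]
  refine Finset.sum_congr rfl fun d _ => ?_
  rw [cylProb_graft p ht hh hL, Y_graft ht hh hL, ← Finset.prod_pow_eq_pow_sum,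
    Finset.prod_mul_distrib, mul_assoc]

section Law

variable {Ω : Type*} [MeasurableSpace Ω] {P : Measure Ω} {p : PMF ℕ} {τ : Ω → Set Node}

theorem IsGW.measurableSet_restrict_eq (hGW : IsGW P p τ) (h : ℕ) (t : Set Node) :
    MeasurableSet {ω | restrict h (τ ω) = t} :=
  hGW.2.1 (MeasurableSpace.measurableSet_generateFrom ⟨h, t, rfl⟩)

theorem IsTree.eq_singleton_nil {t : Set Node} (ht : IsTree t) (hh : ∀ u ∈ t, u.length ≤ 0) :
    t = {[]} := by
  ext u
  constructor
  · intro hu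
    simpa using hh u hu
  · rintro rfl
    exact ht.1

theorem isTree_singleton_nil : IsTree {[]} := by
  refine ⟨rfl, ?_, ?_⟩
  · rintro u rfl v hv
    simpa using hv
  · rintro u rfl
    exact ⟨0, fun i => by simp⟩

theorem cylProb_zero (p : PMF ℕ) (t : Set Node) : cylProb p 0 t = 1 := by
  simp [cylProb]

theorem Y_singleton_nil : Y 0 {[]} = 1 := by
  have : {u ∈ ({[]} : Set Node) | u.length = 0} = {[]} := by
    ext u
    simp
  rw [Y, this, ncard_singleton]

theorem IsTree.restrict_zero {t : Set Node} (ht : IsTree t) : restrict 0 t = {[]} := by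
  ext u
  constructor
  · rintro ⟨-, hu⟩
    simpa using hu
  · rintro rfl
    exact ⟨ht.1, le_rfl⟩

theorem IsGW.measure_restrict_eq [IsProbabilityMeasure P] (hGW : IsGW P p τ) {h : ℕ}
    {t : Set Node} (ht : IsTree t) (hh : ∀ u ∈ t, u.length ≤ h) :
    P {ω | restrict h (τ ω) = t} = cylProb p h t := by
  rcases Nat.eq_zero_or_pos h with rfl | hpos
  · rw [ht.eq_singleton_nil hh, cylProb_zero]
    simp [fun ω => (hGW.1 ω).restrict_zero]
  · exact hGW.2.2 h hpos t ht (height_le_iff.2 hh)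

theorem IsGW.cylDegLe_law [IsProbabilityMeasure P] (hGW : IsGW P p τ) (n k : ℕ) :
    ∀ {h : ℕ} {t : Set Node}, IsTree t → (∀ u ∈ t, u.length ≤ h) →
      MeasurableSet (τ ⁻¹' cylDegLe n h k t) ∧
        P (τ ⁻¹' cylDegLe n h k t) = cylProb p h t * ((truncGen p n)^[k] 1) ^ Y h t := by
  induction k with
  | zero =>
    intro h t ht hh
    have : τ ⁻¹' cylDegLe n h 0 t = {ω | restrict h (τ ω) = t} := by
      ext ω
      simp only [cylDegLe, mem_preimage, mem_ofPred_eq, add_zero, and_iff_left_iff_imp]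
      intro _ u _ h1 h2
      omega
    rw [this]
    exact ⟨hGW.measurableSet_restrict_eq h t, by simp [hGW.measure_restrict_eq ht hh]⟩
  | succ k ih =>
    intro h t ht hh
    have hL : ((ht.finite_level h).toFinset : Set Node) = level h t := by simp
    set L := (ht.finite_level h).toFinset
    have hU : τ ⁻¹' cylDegLe n h (k + 1) t =
        ⋃ d ∈ Fintype.piFinset (fun _ : L => Finset.range (n + 1)),
          τ ⁻¹' cylDegLe n (h + 1) k (graft t L d) := by
      ext ω
      simp only [mem_preimage, mem_iUnion, exists_prop]
      exact mem_cylDegLe_succ_iff (hGW.1 ω) hh hL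
    have ih' := fun d : L → ℕ => ih (ht.graft hh hL d) (length_le_of_mem_graft hh hL d)
    rw [hU]
    refine ⟨Finset.measurableSet_biUnion _ fun d _ => (ih' d).1, ?_⟩
    rw [measure_biUnion_finset _ fun d _ => (ih' d).1, Function.iterate_succ_apply',
      ← truncGen_pow_Y p ht hh hL]
    · exact Finset.sum_congr rfl fun d _ => (ih' d).2
    · intro d _ d' _ hdd
      rw [Function.onFun, Set.disjoint_left]
      intro ω hω hω'
      refine hdd (funext fun u => ?_)
      rw [← ((restrict_succ_eq_graft_iff (hGW.1 ω) hh hL d).1 hω.1).2 u,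
        ← ((restrict_succ_eq_graft_iff (hGW.1 ω) hh hL d').1 hω'.1).2 u]

theorem iInter_cylDegLe {t : Set Node} {n h : ℕ}
    (hdeg : ∀ u ∈ t, u.length < h → deg t u ≤ n) :
    ⋂ k, cylDegLe n h k t = {s | restrict h s = t ∧ maxDeg s ≤ n} := by
  ext s
  simp only [mem_iInter, cylDegLe, mem_ofPred_eq, maxDeg_le_iff]
  constructor
  · intro H
    refine ⟨(H 0).1, fun u hu => ?_⟩
    rcases lt_or_ge u.length h with hl | hl
    · obtain rfl := (H 0).1
      refine le_of_eq_of_le ?_ (hdeg u ⟨hu, hl.le⟩ hl)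
      have (i : ℕ+) : u ++ [i] ∈ restrict h s ↔ u ++ [i] ∈ s :=
        ⟨And.left, fun hi => ⟨hi, by simpa using hl⟩⟩
      simp only [deg, this]
    · exact (H (u.length - h + 1)).2 u hu hl (by omega)
  · rintro ⟨hr, H⟩ k
    exact ⟨hr, fun u hu _ _ => H u hu⟩

theorem IsGW.tendsto_iterate_truncGen [IsProbabilityMeasure P] (hGW : IsGW P p τ) {n h : ℕ}
    {t : Set Node} (ht : IsTree t) (hh : ∀ u ∈ t, u.length ≤ h)
    (hdeg : ∀ u ∈ t, u.length < h → deg t u ≤ n) :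
    Tendsto (fun k => cylProb p h t * ((truncGen p n)^[k] 1) ^ Y h t) atTop
      (𝓝 (P ({ω | restrict h (τ ω) = t} ∩ {ω | maxDeg (τ ω) ≤ n}))) := by
  have hI : {ω | restrict h (τ ω) = t} ∩ {ω | maxDeg (τ ω) ≤ n} =
      ⋂ k, τ ⁻¹' cylDegLe n h k t := by
    rw [← preimage_iInter, iInter_cylDegLe hdeg]
    rfl
  simp only [← (hGW.cylDegLe_law n _ ht hh).2]
  rw [hI]
  refine tendsto_measure_iInter_atTop
    (fun k => (hGW.cylDegLe_law n k ht hh).1.nullMeasurableSet) ?_ ⟨0, measure_ne_top _ _⟩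
  intro k l hkl ω hω
  exact ⟨hω.1, fun u hu h1 h2 => hω.2 u hu h1 (by omega)⟩

theorem IsGW.tendsto_iterate_truncGen_maxDeg [IsProbabilityMeasure P] (hGW : IsGW P p τ)
    (n : ℕ) :
    Tendsto (fun k => (truncGen p n)^[k] 1) atTop (𝓝 (P {ω | maxDeg (τ ω) ≤ n})) := by
  have H := hGW.tendsto_iterate_truncGen (n := n) (h := 0) isTree_singleton_nil
    (by simp) (by simp)
  have hr : {ω | restrict 0 (τ ω) = {[]}} = univ :=
    eq_univ_of_forall fun ω => (hGW.1 ω).restrict_zero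
  simpa [cylProb_zero, Y_singleton_nil, hr] using H

theorem IsGW.measurableSet_maxDeg_le [IsProbabilityMeasure P] (hGW : IsGW P p τ) (n : ℕ) :
    MeasurableSet {ω | maxDeg (τ ω) ≤ n} := by
  have hI : {ω | maxDeg (τ ω) ≤ n} = ⋂ k, τ ⁻¹' cylDegLe n 0 k {[]} := by
    rw [← preimage_iInter, iInter_cylDegLe (by simp)]
    ext ω
    simp [(hGW.1 ω).restrict_zero]
  rw [hI]
  exact MeasurableSet.iInter fun k => (hGW.cylDegLe_law n k isTree_singleton_nil (by simp)).1

/-- The branching property: given `r_h(τ) = t`, the event `M(τ) ≤ n` asks for `Y_h(t)`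
independent copies of `τ` to have maximal out-degree at most `n`. -/
theorem IsGW.measure_restrict_inter_maxDeg_le [IsProbabilityMeasure P] (hGW : IsGW P p τ)
    {n h : ℕ} {t : Set Node} (ht : IsTree t) (hh : ∀ u ∈ t, u.length ≤ h)
    (hdeg : ∀ u ∈ t, u.length < h → deg t u ≤ n) :
    P ({ω | restrict h (τ ω) = t} ∩ {ω | maxDeg (τ ω) ≤ n}) =
      cylProb p h t * P {ω | maxDeg (τ ω) ≤ n} ^ Y h t := by
  refine tendsto_nhds_unique (hGW.tendsto_iterate_truncGen ht hh hdeg) ?_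
  refine ENNReal.Tendsto.const_mul
    (((ENNReal.continuous_pow _).tendsto _).comp (hGW.tendsto_iterate_truncGen_maxDeg n)) (Or.inr ?_)
  rw [← hGW.measure_restrict_eq ht hh]
  exact measure_ne_top _ _

theorem IsGW.truncGen_measure_maxDeg_le [IsProbabilityMeasure P] (hGW : IsGW P p τ) (n : ℕ) :
    truncGen p n (P {ω | maxDeg (τ ω) ≤ n}) = P {ω | maxDeg (τ ω) ≤ n} := by
  refine tendsto_nhds_unique (((continuous_truncGen p n).tendsto _).comp
    (hGW.tendsto_iterate_truncGen_maxDeg n)) ?_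
  have := (tendsto_add_atTop_iff_nat 1).2 (hGW.tendsto_iterate_truncGen_maxDeg n)
  simpa only [Function.iterate_succ_apply', Function.comp_def] using this

theorem IsGW.sum_mul_pow_maxDeg_le [IsProbabilityMeasure P] (hGW : IsGW P p τ) (n : ℕ) :
    ∑ j ∈ Finset.range (n + 1), (p j).toReal * P.real {ω | maxDeg (τ ω) ≤ n} ^ j =
      P.real {ω | maxDeg (τ ω) ≤ n} := by
  have := congrArg ENNReal.toReal (hGW.truncGen_measure_maxDeg_le n)
  rw [truncGen, ENNReal.toReal_sum] at this
  · simpa [measureReal_def] using this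
  · intro j _
    exact ENNReal.mul_ne_top (p.apply_ne_top j) (ENNReal.pow_ne_top (measure_ne_top _ _))

end Law

theorem hasSum_toReal_pmf (p : PMF ℕ) : HasSum (fun j => (p j).toReal) 1 := by
  have := ENNReal.hasSum_toReal (f := p) (by rw [p.tsum_coe]; exact ENNReal.one_ne_top)
  rw [← ENNReal.tsum_toReal_eq p.apply_ne_top, p.tsum_coe] at this
  simpa using this

theorem hasSum_toReal_mean {p : PMF ℕ} (hcrit : mean p = 1) :
    HasSum (fun j : ℕ => (j : ℝ) * (p j).toReal) 1 := by
  have := ENNReal.hasSum_toReal (f := fun j : ℕ => (j : ℝ≥0∞) * p j)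
    (by rw [← mean, hcrit]; exact ENNReal.one_ne_top)
  rw [← ENNReal.tsum_toReal_eq, ← mean, hcrit] at this
  · simpa using this
  · exact fun j => ENNReal.mul_ne_top (ENNReal.natCast_ne_top j) (p.apply_ne_top j)

theorem exists_two_le_of_critical {p : PMF ℕ} (hp1 : p 1 < 1) (hcrit : mean p = 1) :
    ∃ j, 2 ≤ j ∧ p j ≠ 0 := by
  by_contra! H
  rw [mean, tsum_eq_single 1] at hcrit
  · simp only [Nat.cast_one, one_mul] at hcrit
    exact hp1.ne hcrit
  · intro j hj
    rcases Nat.lt_or_ge j 2 with h | h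
    · obtain rfl : j = 0 := by omega
      simp
    · simp [H j h]

theorem one_sub_mul_lt_pow {x : ℝ} (h0 : 0 ≤ x) (h1 : x < 1) {j : ℕ} (hj : 2 ≤ j) :
    1 - j * (1 - x) < x ^ j := by
  induction j, hj using Nat.le_induction with
  | base =>
    push_cast
    nlinarith [mul_pos (sub_pos.2 h1) (sub_pos.2 h1)]
  | succ j hj ih =>
    have hj' : (0 : ℝ) < j := by exact_mod_cast (by omega : 0 < j)
    rw [pow_succ]
    push_cast
    nlinarith [mul_le_mul_of_nonneg_right ih.le h0,
      mul_pos hj' (mul_pos (sub_pos.2 h1) (sub_pos.2 h1))]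

/-- The generating function of a nondegenerate critical law has no fixed point in `[0, 1)`. -/
theorem eq_one_of_hasSum_pow {p : PMF ℕ} (hp1 : p 1 < 1) (hcrit : mean p = 1) {x : ℝ}
    (h0 : 0 ≤ x) (h1 : x ≤ 1) (hx : HasSum (fun j => (p j).toReal * x ^ j) x) : x = 1 := by
  by_contra hne
  have hlt : x < 1 := lt_of_le_of_ne h1 hne
  have hsum : HasSum (fun j : ℕ => (p j).toReal * (x ^ j - (1 - j * (1 - x)))) 0 := by
    have := (hx.sub (hasSum_toReal_pmf p)).add ((hasSum_toReal_mean hcrit).mul_left (1 - x))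
    rw [show x - 1 + (1 - x) * 1 = 0 by ring] at this
    refine this.congr_fun ?_
    intro j
    ring
  have hnn : ∀ j : ℕ, 0 ≤ (p j).toReal * (x ^ j - (1 - j * (1 - x))) := by
    intro j
    refine mul_nonneg ENNReal.toReal_nonneg (sub_nonneg.2 ?_)
    have := one_add_mul_sub_le_pow (a := x) (by linarith) j
    linarith
  obtain ⟨j, hj, hpj⟩ := exists_two_le_of_critical hp1 hcrit
  have hzero := congrFun ((hasSum_zero_iff_of_nonneg hnn).1 hsum) j
  have hpos : 0 < (p j).toReal := ENNReal.toReal_pos hpj (p.apply_ne_top j)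
  exact (mul_pos hpos (sub_pos.2 (one_sub_mul_lt_pow h0 hlt hj))).ne' hzero

/-- If each `x n` is a fixed point of the generating function truncated at degree `n`, and `x` is
monotone with values in `[0, 1]`, then `x` tends to `1`. -/
theorem tendsto_one_of_truncated_fixed_points {p : PMF ℕ} (hp1 : p 1 < 1) (hcrit : mean p = 1)
    {x : ℕ → ℝ} (hmono : Monotone x) (h0 : ∀ n, 0 ≤ x n) (h1 : ∀ n, x n ≤ 1)
    (hfix : ∀ n, ∑ j ∈ Finset.range (n + 1), (p j).toReal * x n ^ j = x n) :
    Tendsto x atTop (𝓝 1) := by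
  have hlim : Tendsto x atTop (𝓝 (⨆ n, x n)) :=
    tendsto_atTop_ciSup hmono ⟨1, by rintro _ ⟨n, rfl⟩; exact h1 n⟩
  set l := ⨆ n, x n
  have hl0 : 0 ≤ l := ge_of_tendsto' hlim h0
  have hl1 : l ≤ 1 := le_of_tendsto' hlim h1
  have hdom : Tendsto
      (fun n => ∑' j, if j ∈ Finset.range (n + 1) then (p j).toReal * x n ^ j else 0) atTop
      (𝓝 (∑' j, (p j).toReal * l ^ j)) := by
    refine tendsto_tsum_of_dominated_convergence (hasSum_toReal_pmf p).summable ?_ ?_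
    · intro j
      refine ((hlim.pow j).const_mul _).congr' ?_
      filter_upwards [eventually_ge_atTop j] with n hn
      rw [if_pos (by simp; omega)]
    · refine Eventually.of_forall fun n j => ?_
      split_ifs
      · rw [Real.norm_of_nonneg (mul_nonneg ENNReal.toReal_nonneg (pow_nonneg (h0 n) j))]
        exact mul_le_of_le_one_right ENNReal.toReal_nonneg (pow_le_one₀ (h0 n) (h1 n))
      · simp
  have hpart (n : ℕ) :
      ∑' j, (if j ∈ Finset.range (n + 1) then (p j).toReal * x n ^ j else 0) = x n := by
    rw [tsum_eq_sum (s := Finset.range (n + 1)) fun j hj => if_neg hj,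
      Finset.sum_congr rfl fun j hj => if_pos hj, hfix]
  simp only [hpart] at hdom
  have hsummable : Summable fun j => (p j).toReal * l ^ j :=
    (hasSum_toReal_pmf p).summable.of_nonneg_of_le
      (fun j => mul_nonneg ENNReal.toReal_nonneg (pow_nonneg hl0 j))
      (fun j => mul_le_of_le_one_right ENNReal.toReal_nonneg (pow_le_one₀ hl0 hl1))
  have hl : HasSum (fun j => (p j).toReal * l ^ j) l := by
    have := hsummable.hasSum
    rwa [← tendsto_nhds_unique hlim hdom] at this
  rwa [eq_one_of_hasSum_pow hp1 hcrit hl0 hl1 hl] at hlim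

theorem setOf_maxDeg_eq_succ {Ω : Type*} (τ : Ω → Set Node) (n : ℕ) :
    {ω | maxDeg (τ ω) = ((n + 1 : ℕ) : ℕ∞)} =
      {ω | maxDeg (τ ω) ≤ ((n + 1 : ℕ) : ℕ∞)} \ {ω | maxDeg (τ ω) ≤ (n : ℕ∞)} := by
  ext ω
  simp only [mem_ofPred_eq, Set.mem_sdiff, not_le]
  rw [← Order.add_one_le_iff_of_not_isMax (by simp), le_antisymm_iff]
  simp

theorem setOf_maxDeg_le_subset {Ω : Type*} (τ : Ω → Set Node) {m n : ℕ} (hmn : m ≤ n) :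
    {ω | maxDeg (τ ω) ≤ (m : ℕ∞)} ⊆ {ω | maxDeg (τ ω) ≤ (n : ℕ∞)} :=
  fun _ hω => le_trans (mem_ofPred_eq ▸ hω) (Nat.cast_le.2 hmn)

/-- **Corollary (local convergence under conditioning on the maximal out-degree).**
Let `τ` be a critical GW tree with offspring distribution `p`. Then, along
`{n ∈ ℕ : p_n > 0}`, `τ` conditioned on `{M(τ) = n}` converges locally in distribution to
Kesten's immortal tree `τ*`. -/
theorem gw_maxDeg_local_convergence
    {Ω : Type*} [MeasurableSpace Ω] (P : Measure Ω) [IsProbabilityMeasure P]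
    (p : PMF ℕ) (hp1 : p 1 < 1) (hcrit : mean p = 1)
    (τ : Ω → Set Node) (hGW : IsGW P p τ) :
    ∀ h : ℕ, 1 ≤ h → ∀ t : Set Node, IsTree t → height t ≤ (h : ℕ∞) →
      Tendsto
        (fun n : ℕ =>
          P ({ω | restrict h (τ ω) = t} ∩ {ω | maxDeg (τ ω) = (n : ℕ∞)}) /
            P {ω | maxDeg (τ ω) = (n : ℕ∞)})
        (atTop ⊓ 𝓟 {n : ℕ | p n ≠ 0}) (𝓝 (kesten p h t)) := by
  intro h _ t ht hht
  have hh := height_le_iff.1 hht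
  set x : ℕ → ℝ := fun n => P.real {ω | maxDeg (τ ω) ≤ (n : ℕ∞)} with hx
  set c : ℝ := (cylProb p h t).toReal with hc
  set m := Y h t with hm
  have hcyl : cylProb p h t ≠ ∞ := by
    rw [← hGW.measure_restrict_eq ht hh]
    exact measure_ne_top _ _
  have hmono : Monotone x := fun a b hab => measureReal_mono (setOf_maxDeg_le_subset τ hab)
  have hfix := hGW.sum_mul_pow_maxDeg_le
  have hxlim : Tendsto x atTop (𝓝 1) :=
    tendsto_one_of_truncated_fixed_points hp1 hcrit hmono (fun n => measureReal_nonneg)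
      (fun n => measureReal_le_one) hfix
  have hylim : Tendsto (fun n => x (n - 1)) atTop (𝓝 1) :=
    hxlim.comp (tendsto_sub_atTop_nat 1)
  have hkes : kesten p h t = ENNReal.ofReal (c * ∑ i ∈ Finset.range m, 1 ^ i * 1 ^ (m - 1 - i)) := by
    rw [kesten, hcrit, ENNReal.ofReal_mul ENNReal.toReal_nonneg, ENNReal.ofReal_toReal hcyl]
    simp [mul_comm, hm]
  have hlim : Tendsto (fun n => ENNReal.ofReal
      (c * ∑ i ∈ Finset.range m, x n ^ i * x (n - 1) ^ (m - 1 - i)))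
      (atTop ⊓ 𝓟 {n : ℕ | p n ≠ 0}) (𝓝 (kesten p h t)) := by
    rw [hkes]
    refine (ENNReal.continuous_ofReal.tendsto _).comp (Tendsto.mono_left ?_ inf_le_left)
    exact (tendsto_finsetSum _ fun i _ => (hxlim.pow i).mul (hylim.pow _)).const_mul c
  refine hlim.congr' ?_
  obtain ⟨D, hD⟩ := ((ht.finite_lt h).image (deg t)).bddAbove
  have hdeg : ∀ n, D ≤ n → ∀ u ∈ t, u.length < h → deg t u ≤ n := fun n hn u hu hl =>
    (hD (mem_image_of_mem _ ⟨hu, hl⟩)).trans hn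
  rw [EventuallyEq, eventually_inf_principal]
  filter_upwards [eventually_gt_atTop D, hxlim.eventually (lt_mem_nhds one_pos)]
    with n hn hxpos hpn
  obtain ⟨n, rfl⟩ : ∃ k, n = k + 1 := ⟨n - 1, by omega⟩
  have hlaw (k : ℕ) (hk : D ≤ k) :
      P.real ({ω | restrict h (τ ω) = t} ∩ {ω | maxDeg (τ ω) ≤ (k : ℕ∞)}) = c * x k ^ m := by
    simp [measureReal_def, hGW.measure_restrict_inter_maxDeg_le ht hh (hdeg k hk), hc, hx, hm]
  have hden : P.real {ω | maxDeg (τ ω) = ((n + 1 : ℕ) : ℕ∞)} = x (n + 1) - x n := by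
    rw [setOf_maxDeg_eq_succ, measureReal_sdiff (setOf_maxDeg_le_subset τ n.le_succ)
      (hGW.measurableSet_maxDeg_le n)]
  have hnum : P.real ({ω | restrict h (τ ω) = t} ∩ {ω | maxDeg (τ ω) = ((n + 1 : ℕ) : ℕ∞)}) =
      c * x (n + 1) ^ m - c * x n ^ m := by
    rw [setOf_maxDeg_eq_succ, inter_sdiff_distrib_left, measureReal_sdiff
      (inter_subset_inter_right _ (setOf_maxDeg_le_subset τ n.le_succ))
      ((hGW.measurableSet_restrict_eq h t).inter (hGW.measurableSet_maxDeg_le n)),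
      hlaw _ (by omega), hlaw _ (by omega)]
  have hpos : 0 < x (n + 1) - x n := by
    refine sub_pos.2 (lt_of_le_of_ne (hmono n.le_succ) fun heq => ?_)
    have h1 := hfix (n + 1)
    have h2 := hfix n
    change ∑ j ∈ Finset.range (n + 1 + 1), (p j).toReal * x (n + 1) ^ j = x (n + 1) at h1
    change ∑ j ∈ Finset.range (n + 1), (p j).toReal * x n ^ j = x n at h2
    rw [Finset.sum_range_succ, ← heq, h2] at h1
    have hp : 0 < (p (n + 1)).toReal := ENNReal.toReal_pos hpn (p.apply_ne_top _)
    rw [← heq] at hxpos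
    have := mul_pos hp (pow_pos hxpos (n + 1))
    linarith
  rw [← ofReal_measureReal, ← ofReal_measureReal (μ := P) (s := {ω | maxDeg (τ ω) = _}),
    ← ENNReal.ofReal_div_of_pos (hden ▸ hpos), hnum, hden]
  congr 1
  rw [eq_div_iff hpos.ne', mul_assoc, Nat.add_sub_cancel, geom_sum₂_mul]
  ring

end GWLocal
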